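/- Let q be a Boolean conjunctive query without self-join and q' ⊆ q such that every atom of q \ q' is all-key and contains no constants. Let db be a nonempty uncertain database with active domain D, and define f(db) = {A ∈ db : the relation name of A occurs in q'} ∪ {R(a_1,…,a_n) : R(s_1,…,s_n) ∈ q \ q' and a_1,…,a_n ∈ D}. Then db ∈ CERTAINTY(q') if and only if f(db) ∈ CERTAINTY(q). -/

import Mathlib

attribute [local instance] Classical.propDecidable

noncomputable section

/-- A term is either a variable (`Sum.inl v`) or a constant (`Sum.inr c`),
variables and constants both being coded by natural numbers
(the two copies of `ℕ` are disjoint). -/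
abbrev Trm := ℕ ⊕ ℕ

/-- A database schema assigns to every relation name (a natural number) an
arity `n` and a primary-key length `k` with `n ≥ k ≥ 1`; the primary key
consists of the first `k` positions. -/
structure Schema where
  arity : ℕ → ℕ
  keyLen : ℕ → ℕ
  keyLen_le_arity : ∀ R, keyLen R ≤ arity R
  one_le_keyLen : ∀ R, 1 ≤ keyLen R

/-- An atom: a relation name together with a list of arguments. -/
structure Atom where
  rel : ℕ
  args : List Trm
deriving DecidableEq

/-- Variables occurring in a list of terms. -/
def varsL (l : List Trm) : Finset ℕ := (l.filterMap Sum.getLeft?).toFinset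

/-- Constants occurring in a list of terms. -/
def constsL (l : List Trm) : Finset ℕ := (l.filterMap Sum.getRight?).toFinset

/-- All variables of an atom. -/
def varsA (A : Atom) : Finset ℕ := varsL A.args

/-- Key variables of an atom: variables in the primary-key positions. -/
def keyVars (S : Schema) (A : Atom) : Finset ℕ := varsL (A.args.take (S.keyLen A.rel))

/-- Constants of an atom. -/
def constsA (A : Atom) : Finset ℕ := constsL A.args

/-- Well-formed atom: number of arguments equals the arity of its relation name. -/
def wfAtom (S : Schema) (A : Atom) : Prop := A.args.length = S.arity A.rel

/-- A fact is an atom without variables. -/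
def isFact (A : Atom) : Prop := ∀ t ∈ A.args, ∃ c : ℕ, t = Sum.inr c

/-- Two (facts) are key-equal: same relation name, and same primary-key positions. -/
def keyEqual (S : Schema) (A B : Atom) : Prop :=
  A.rel = B.rel ∧ A.args.take (S.keyLen A.rel) = B.args.take (S.keyLen B.rel)

/-- The block of `A` in `db`: all facts of `db` key-equal to `A`. -/
def block (S : Schema) (A : Atom) (db : Finset Atom) : Finset Atom :=
  db.filter (fun B => keyEqual S A B)

/-- An uncertain database: a finite set of well-formed facts. -/
def IsDb (S : Schema) (db : Finset Atom) : Prop := ∀ A ∈ db, isFact A ∧ wfAtom S A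

/-- A set of facts is consistent if it contains no two distinct key-equal facts. -/
def Consistent (S : Schema) (db : Finset Atom) : Prop :=
  ∀ A ∈ db, ∀ B ∈ db, keyEqual S A B → A = B

/-- A repair of `db`: a maximal consistent subset of `db`. -/
def IsRepair (S : Schema) (db r : Finset Atom) : Prop :=
  r ⊆ db ∧ Consistent S r ∧
    ∀ r' : Finset Atom, r ⊆ r' → r' ⊆ db → Consistent S r' → r' = r

/-- Applying a valuation (a total map from variables to constants) to a term. -/
def appT (θ : ℕ → ℕ) : Trm → Trm
  | Sum.inl v => Sum.inr (θ v)
  | Sum.inr c => Sum.inr c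

/-- Applying a valuation to an atom. -/
def appA (θ : ℕ → ℕ) (A : Atom) : Atom := ⟨A.rel, A.args.map (appT θ)⟩

/-- Applying a valuation to a query. -/
def appQ (θ : ℕ → ℕ) (q : Finset Atom) : Finset Atom := q.image (appA θ)

/-- `db ⊨ q`: some valuation sends every atom of `q` into `db`. -/
def Sat (db q : Finset Atom) : Prop := ∃ θ : ℕ → ℕ, appQ θ q ⊆ db

/-- `db ∈ CERTAINTY(q)`: every repair of `db` satisfies `q`. -/
def Certainty (S : Schema) (q db : Finset Atom) : Prop :=
  ∀ r : Finset Atom, IsRepair S db r → Sat r q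

/-- Variables of a query. -/
def varsQ (q : Finset Atom) : Finset ℕ := q.biUnion varsA

/-- Constants of a query. -/
def constsQ (q : Finset Atom) : Finset ℕ := q.biUnion constsA

/-- `q` has no self-join: no two distinct atoms share a relation name. -/
def NoSelfJoin (q : Finset Atom) : Prop := ∀ F ∈ q, ∀ G ∈ q, F.rel = G.rel → F = G

/-- `db` is purified relative to `q`. -/
def Purified (q db : Finset Atom) : Prop :=
  ∀ A ∈ db, ∃ θ : ℕ → ℕ, A ∈ appQ θ q ∧ appQ θ q ⊆ db

/-- Active domain of a database: all constants occurring in its facts. -/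
def adom (db : Finset Atom) : Finset ℕ := db.biUnion constsA

/-- Membership in the attribute closure of `X` under a set `FDs` of
functional dependencies (standard implication of functional dependencies). -/
inductive InCl (FDs : Set (Finset ℕ × Finset ℕ)) (X : Finset ℕ) : ℕ → Prop
  | base {x : ℕ} : x ∈ X → InCl FDs X x
  | step {Z W : Finset ℕ} {w : ℕ} : (Z, W) ∈ FDs → (∀ z ∈ Z, InCl FDs X z) →
      w ∈ W → InCl FDs X w

/-- `FDs ⊨ X → Y`. -/
def FDImp (FDs : Set (Finset ℕ × Finset ℕ)) (X Y : Finset ℕ) : Prop :=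
  ∀ y ∈ Y, InCl FDs X y

/-- `FD(q) = { key(F) → vars(F) : F ∈ q }`. -/
def FDq (S : Schema) (q : Finset Atom) : Set (Finset ℕ × Finset ℕ) :=
  {p | ∃ F ∈ q, p = (keyVars S F, varsA F)}

/-- `F^{+,q} = {x ∈ vars(q) : FD(q \ {F}) ⊨ key(F) → x}`. -/
def plusCl (S : Schema) (q : Finset Atom) (F : Atom) : Set ℕ :=
  {x | x ∈ varsQ q ∧ InCl (FDq S (q.erase F)) (keyVars S F) x}

/-- `F^{⊕,q} = {x ∈ vars(q) : FD(q) ⊨ key(F) → x}`. -/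
def oplusCl (S : Schema) (q : Finset Atom) (F : Atom) : Set ℕ :=
  {x | x ∈ varsQ q ∧ InCl (FDq S q) (keyVars S F) x}

/-- A (simple) path in an undirected graph given by edge relation `E`. -/
def IsPath (E : Atom → Atom → Prop) (p : List Atom) : Prop :=
  p ≠ [] ∧ p.Nodup ∧ List.Chain' E p

/-- `E` is (the edge relation of) a join tree for `q`: a tree (unique simple
paths between any two vertices) on the atoms of `q` satisfying the
Connectedness Condition. -/
def IsJoinTree (q : Finset Atom) (E : Atom → Atom → Prop) : Prop :=
  (∀ a b, E a b → E b a) ∧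
  (∀ a b, E a b → a ∈ q ∧ b ∈ q ∧ a ≠ b) ∧
  (∀ a ∈ q, ∀ b ∈ q, ∃! p : List Atom,
      IsPath E p ∧ p.head? = some a ∧ p.getLast? = some b) ∧
  (∀ x : ℕ, ∀ F ∈ q, ∀ G ∈ q, x ∈ varsA F → x ∈ varsA G →
      ∀ p : List Atom, IsPath E p → p.head? = some F → p.getLast? = some G →
        ∀ H ∈ p, x ∈ varsA H)

/-- The consecutive pairs (edges) of a path. -/
def edgePairs (p : List Atom) : List (Atom × Atom) := p.zip p.tail

/-- `F ↝ G` in the attack graph of the join tree `E` of `q`: `F ≠ G` are atoms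
of `q`, and no label `vars(H) ∩ vars(H')` of an edge on the (unique) path from
`F` to `G` is contained in `F^{+,q}`. -/
def Attacks (S : Schema) (q : Finset Atom) (E : Atom → Atom → Prop) (F G : Atom) : Prop :=
  F ∈ q ∧ G ∈ q ∧ F ≠ G ∧
  ∀ p : List Atom, IsPath E p → p.head? = some F → p.getLast? = some G →
    ∀ e ∈ edgePairs p, ¬ ((↑(varsA e.1 ∩ varsA e.2) : Set ℕ) ⊆ plusCl S q F)

/-- The attack `F ↝ G` is weak: `key(G) ⊆ F^{⊕,q}`. -/
def Weak (S : Schema) (q : Finset Atom) (F G : Atom) : Prop :=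
  (↑(keyVars S G) : Set ℕ) ⊆ oplusCl S q F

/-- Consecutive pairs of a cyclic sequence, including the wrap-around pair. -/
def cyclePairs (L : List Atom) : List (Atom × Atom) := L.zip (L.rotate 1)

/-- `L` is an (elementary directed) cycle in the directed graph `att`. -/
def IsCycle (att : Atom → Atom → Prop) (L : List Atom) : Prop :=
  2 ≤ L.length ∧ L.Nodup ∧ ∀ e ∈ cyclePairs L, att e.1 e.2

/-- A cycle is terminal: no edge leads from a vertex in the cycle to a vertex
outside the cycle. -/
def TerminalCycle (att : Atom → Atom → Prop) (L : List Atom) : Prop :=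
  ∀ a ∈ L, ∀ b, att a b → b ∈ L

/-- A strong cycle in the attack graph: a cycle at least one attack of which is strong. -/
def StrongCycle (S : Schema) (q : Finset Atom) (E : Atom → Atom → Prop)
    (L : List Atom) : Prop :=
  IsCycle (Attacks S q E) L ∧ ∃ e ∈ cyclePairs L, ¬ Weak S q e.1 e.2

/-- Substituting constant `c` for variable `z` in a term. -/
def substT (z c : ℕ) : Trm → Trm
  | Sum.inl v => if v = z then Sum.inr c else Sum.inl v
  | Sum.inr d => Sum.inr d

/-- `F[z→c]`. -/
def substA (z c : ℕ) (A : Atom) : Atom := ⟨A.rel, A.args.map (substT z c)⟩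

/-- `q[z→c]`. -/
def substQ (z c : ℕ) (q : Finset Atom) : Finset Atom := q.image (substA z c)

/-- Simultaneous substitution of the constants `bs` for the (distinct)
variables `xs` (componentwise) in a term. -/
def substLT (xs bs : List ℕ) : Trm → Trm
  | Sum.inl v => if v ∈ xs then Sum.inr (bs.getD (xs.idxOf v) 0) else Sum.inl v
  | Sum.inr d => Sum.inr d

/-- `F[x⃗→b⃗]`. -/
def substLA (xs bs : List ℕ) (A : Atom) : Atom := ⟨A.rel, A.args.map (substLT xs bs)⟩

/-- `q[x⃗→b⃗]`. -/
def substLQ (xs bs : List ℕ) (q : Finset Atom) : Finset Atom := q.image (substLA xs bs)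

/-- First-order formulas over the relational vocabulary (relation names and
constants coded by naturals, variables coded by naturals). -/
inductive Fml where
  | atom (R : ℕ) (args : List Trm)
  | eq (s t : Trm)
  | tru
  | not (φ : Fml)
  | and (φ ψ : Fml)
  | or (φ ψ : Fml)
  | ex (v : ℕ) (φ : Fml)
  | all (v : ℕ) (φ : Fml)

/-- Value of a term under an assignment of constants to variables. -/
def evalT (σ : ℕ → ℕ) : Trm → ℕ
  | Sum.inl v => σ v
  | Sum.inr c => c

/-- Satisfaction of a first-order formula in the finite structure whose
relations are given by the facts of `db`, with quantifiers ranging over `dom`. -/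
def Holds (db : Finset Atom) (dom : Finset ℕ) : Fml → (ℕ → ℕ) → Prop
  | .atom R args, σ => (⟨R, args.map fun t => Sum.inr (evalT σ t)⟩ : Atom) ∈ db
  | .eq s t, σ => evalT σ s = evalT σ t
  | .tru, _ => True
  | .not φ, σ => ¬ Holds db dom φ σ
  | .and φ ψ, σ => Holds db dom φ σ ∧ Holds db dom ψ σ
  | .or φ ψ, σ => Holds db dom φ σ ∨ Holds db dom ψ σ
  | .ex v φ, σ => ∃ a ∈ dom, Holds db dom φ (Function.update σ v a)
  | .all v φ, σ => ∀ a ∈ dom, Holds db dom φ (Function.update σ v a)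

/-- Free variables of a formula. -/
def Fml.free : Fml → Finset ℕ
  | .atom _ args => varsL args
  | .eq s t => varsL [s, t]
  | .tru => ∅
  | .not φ => φ.free
  | .and φ ψ => φ.free ∪ ψ.free
  | .or φ ψ => φ.free ∪ ψ.free
  | .ex v φ => φ.free.erase v
  | .all v φ => φ.free.erase v

/-- Relation names occurring in a formula. -/
def Fml.rels : Fml → Finset ℕ
  | .atom R _ => {R}
  | .eq _ _ => ∅
  | .tru => ∅
  | .not φ => φ.rels
  | .and φ ψ => φ.rels ∪ ψ.rels
  | .or φ ψ => φ.rels ∪ ψ.rels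
  | .ex _ φ => φ.rels
  | .all _ φ => φ.rels

/-- Constants occurring in a formula. -/
def Fml.consts : Fml → Finset ℕ
  | .atom _ args => constsL args
  | .eq s t => constsL [s, t]
  | .tru => ∅
  | .not φ => φ.consts
  | .and φ ψ => φ.consts ∪ ψ.consts
  | .or φ ψ => φ.consts ∪ ψ.consts
  | .ex _ φ => φ.consts
  | .all _ φ => φ.consts

/-- Well-formed formula: every atom has as many arguments as the arity of its
relation name. -/
def FmlWf (S : Schema) : Fml → Prop
  | .atom R args => args.length = S.arity R
  | .eq _ _ => True
  | .tru => True
  | .not φ => FmlWf S φ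
  | .and φ ψ => FmlWf S φ ∧ FmlWf S ψ
  | .or φ ψ => FmlWf S φ ∧ FmlWf S ψ
  | .ex _ φ => FmlWf S φ
  | .all _ φ => FmlWf S φ

/-- The safety predicate of Dalvi, Ré and Suciu (rules SE1–SE4). -/
inductive Safe (S : Schema) : Finset Atom → Prop
  | se1 (A : Atom) : isFact A → Safe S {A}
  | se2 (q₁ q₂ : Finset Atom) : q₁.Nonempty → q₂.Nonempty →
      Disjoint (varsQ q₁) (varsQ q₂) → Safe S q₁ → Safe S q₂ → Safe S (q₁ ∪ q₂)
  | se3 (q : Finset Atom) (x a : ℕ) : (∀ F ∈ q, x ∈ keyVars S F) →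
      Safe S (substQ x a q) → Safe S q
  | se4 (q : Finset Atom) (F : Atom) (x a : ℕ) : F ∈ q → keyVars S F = ∅ →
      varsA F ≠ ∅ → x ∈ varsA F → Safe S (substQ x a q) → Safe S q

/-- The atom `R_i(x_i ; x_{i+1})` (with `x_{k+1} = x_1`) of the query `acq_k`;
variable `x_i` is coded by `i`, relation name `R_i` by `i`. -/
def Ratom (k i : ℕ) : Atom := ⟨i, [Sum.inl i, Sum.inl (i % k + 1)]⟩

/-- The all-key atom `S_k(x_1,…,x_k)` of the query `acq_k`;
relation name `S_k` is coded by `0`. -/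
def Satom (k : ℕ) : Atom := ⟨0, (List.range k).map (fun j => Sum.inl (j + 1))⟩

/-- The query `acq_k = {R_1(x_1;x_2), …, R_k(x_k;x_1), S_k(x_1,…,x_k)}`. -/
def acq (k : ℕ) : Finset Atom := ((Finset.Icc 1 k).image (Ratom k)) ∪ {Satom k}

/-- Sum of `Pr` over the possible (= consistent) worlds of `db` satisfying `P`. -/
def prOf (S : Schema) (db : Finset Atom) (Pr : Finset Atom → ℚ)
    (P : Finset Atom → Prop) : ℚ :=
  ∑ w ∈ db.powerset.filter (fun w => Consistent S w ∧ P w), Pr w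

end

theorem keyEqual_symm' {S : Schema} {A B : Atom} (h : keyEqual S A B) : keyEqual S B A :=
  ⟨h.1.symm, h.2.symm⟩

theorem isRepair_of_cover {S : Schema} {db r : Finset Atom} (h1 : r ⊆ db)
    (h2 : Consistent S r) (h3 : ∀ A ∈ db, ∃ B ∈ r, keyEqual S A B) : IsRepair S db r := by
  refine ⟨h1, h2, fun r' hr hr' hc => ?_⟩
  refine Finset.Subset.antisymm (fun A hA => ?_) hr
  obtain ⟨B, hB, hk⟩ := h3 A (hr' hA)
  rw [hc A hA B (hr hB) hk]
  exact hB

theorem cover_of_isRepair {S : Schema} {db r : Finset Atom} (h : IsRepair S db r) :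
    ∀ A ∈ db, ∃ B ∈ r, keyEqual S A B := by
  intro A hA
  by_contra hcon
  push Not at hcon
  have hAr : A ∉ r := fun hr => hcon A hr ⟨rfl, rfl⟩
  have := h.2.2 (insert A r) (Finset.subset_insert _ _)
    (Finset.insert_subset hA h.1) (by
      intro X hX Y hY hXY
      rw [Finset.mem_insert] at hX hY
      rcases hX with rfl | hX <;> rcases hY with rfl | hY
      · rfl
      · exact absurd hXY (hcon Y hY)
      · exact absurd (keyEqual_symm' hXY) (hcon X hX)
      · exact h.2.1 X hX Y hY hXY)
  exact hAr (this ▸ Finset.mem_insert_self A r)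

theorem exists_isRepair (S : Schema) (db : Finset Atom) : ∃ r, IsRepair S db r := by
  obtain ⟨r, hr, hmax⟩ := Finset.exists_max_image
    (db.powerset.filter (fun w => Consistent S w)) Finset.card
    ⟨∅, Finset.mem_filter.2 ⟨Finset.empty_mem_powerset _, by simp [Consistent]⟩⟩
  simp only [Finset.mem_filter, Finset.mem_powerset] at hr hmax
  exact ⟨r, hr.1, hr.2, fun r' h1 h2 h3 =>
    (Finset.eq_of_subset_of_card_le h1 (hmax r' ⟨h2, h3⟩)).symm⟩

theorem eq_of_allKey {S : Schema} {A B : Atom} (hA : wfAtom S A) (hB : wfAtom S B)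
    (hk : S.keyLen A.rel = S.arity A.rel) (h : keyEqual S A B) : A = B := by
  obtain ⟨h1, h2⟩ := h
  rw [List.take_of_length_le (by rw [hA, hk]),
    List.take_of_length_le (by rw [hB, ← h1, hk])] at h2
  cases A; cases B; simp_all

theorem mem_constsA {A : Atom} {c : ℕ} : c ∈ constsA A ↔ Sum.inr c ∈ A.args := by
  simp [constsA, constsL]

/-- If `q' ⊆ q` and every atom of `q \ q'` is all-key without
constants, then for nonempty `db`, `db ∈ CERTAINTY(q')` iff
`f(db) ∈ CERTAINTY(q)`, where `f(db)` keeps the facts of `db` over relation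
names of `q'` and adds all facts `R(a⃗)` over the active domain for
`R(s⃗) ∈ q \ q'`. -/
theorem statement13 (S : Schema) (q q' : Finset Atom) (hq : ∀ F ∈ q, wfAtom S F)
    (hnsj : NoSelfJoin q) (hsub : q' ⊆ q)
    (hallkey : ∀ F ∈ q \ q', S.keyLen F.rel = S.arity F.rel ∧ constsA F = ∅)
    (db : Finset Atom) (hdb : IsDb S db) (hne : db.Nonempty)
    (fdb : Finset Atom)
    (hfdb : ∀ A : Atom, A ∈ fdb ↔
      ((A ∈ db ∧ ∃ F ∈ q', A.rel = F.rel) ∨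
       (∃ F ∈ q \ q', A.rel = F.rel ∧ A.args.length = F.args.length ∧
          ∀ t ∈ A.args, ∃ a ∈ adom db, t = Sum.inr a))) :
    Certainty S q' db ↔ Certainty S q fdb := by
  obtain ⟨d, hd⟩ : ∃ d, d ∈ adom db := by
    obtain ⟨A, hA⟩ := hne
    obtain ⟨hf, hw⟩ := hdb A hA
    have hlen : 0 < A.args.length := by
      have h1 := S.one_le_keyLen A.rel
      have h2 := S.keyLen_le_arity A.rel
      rw [hw]; omega
    obtain ⟨t, ht⟩ := List.exists_mem_of_length_pos hlen
    obtain ⟨c, rfl⟩ := hf t ht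
    exact ⟨c, Finset.mem_biUnion.2 ⟨A, hA, mem_constsA.2 ht⟩⟩
  have hfwf : ∀ A ∈ fdb, wfAtom S A := by
    intro A hA
    rcases (hfdb A).1 hA with ⟨h, -⟩ | ⟨F, hF, h1, h2, -⟩
    · exact (hdb A h).2
    · have := hq F (Finset.mem_sdiff.1 hF).1
      unfold wfAtom at *
      rw [h2, this, h1]
  have hdisj : ∀ F ∈ q', ∀ G ∈ q \ q', F.rel ≠ G.rel := by
    intro F hF G hG h
    rw [Finset.mem_sdiff] at hG
    exact hG.2 (hnsj F (hsub hF) G hG.1 h ▸ hF)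
  -- facts of `fdb` over relation names of `q'` are those of `db`
  have hin : ∀ A, (∃ F ∈ q', A.rel = F.rel) → (A ∈ fdb ↔ A ∈ db) := by
    rintro A ⟨F, hF, hAF⟩
    rw [hfdb]
    constructor
    · rintro (⟨h, -⟩ | ⟨G, hG, h1, -⟩)
      · exact h
      · exact absurd (hAF.symm.trans h1) (hdisj F hF G hG)
    · exact fun h => Or.inl ⟨h, F, hF, hAF⟩
  -- other facts of `fdb` are all-key
  have hout : ∀ A ∈ fdb, (¬ ∃ F ∈ q', A.rel = F.rel) → S.keyLen A.rel = S.arity A.rel := by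
    intro A hA hn
    rcases (hfdb A).1 hA with ⟨-, h⟩ | ⟨F, hF, h1, -⟩
    · exact absurd h hn
    · rw [h1]; exact (hallkey F hF).1
  constructor
  · intro hC r hr
    have hrc := cover_of_isRepair hr
    obtain ⟨s, hs⟩ := exists_isRepair S db
    have hsc := cover_of_isRepair hs
    obtain ⟨θ, hθ⟩ := hC (r.filter (fun A => ∃ F ∈ q', A.rel = F.rel) ∪
      s.filter (fun A => ¬ ∃ F ∈ q', A.rel = F.rel)) (by
        apply isRepair_of_cover
        · intro A hA
          rw [Finset.mem_union, Finset.mem_filter, Finset.mem_filter] at hA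
          rcases hA with hA | hA
          · exact (hin A hA.2).1 (hr.1 hA.1)
          · exact hs.1 hA.1
        · intro A hA B hB hAB
          rw [Finset.mem_union, Finset.mem_filter, Finset.mem_filter, hAB.1] at hA
          rw [Finset.mem_union, Finset.mem_filter, Finset.mem_filter] at hB
          rcases hA with hA | hA <;> rcases hB with hB | hB
          · exact hr.2.1 A hA.1 B hB.1 hAB
          · exact absurd hA.2 hB.2
          · exact absurd hB.2 hA.2
          · exact hs.2.1 A hA.1 B hB.1 hAB
        · intro A hA
          by_cases h : ∃ F ∈ q', A.rel = F.rel
          · obtain ⟨B, hB, hAB⟩ := hrc A ((hin A h).2 hA)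
            refine ⟨B, ?_, hAB⟩
            rw [Finset.mem_union, Finset.mem_filter]
            exact Or.inl ⟨hB, hAB.1 ▸ h⟩
          · obtain ⟨B, hB, hAB⟩ := hsc A hA
            refine ⟨B, ?_, hAB⟩
            rw [Finset.mem_union, Finset.mem_filter, Finset.mem_filter]
            exact Or.inr ⟨hB, hAB.1 ▸ h⟩)
    have hθ' : ∀ F ∈ q', appA θ F ∈ r := by
      intro F hF
      have := hθ (Finset.mem_image_of_mem _ hF)
      rw [Finset.mem_union, Finset.mem_filter, Finset.mem_filter] at this
      rcases this with h | h
      · exact h.1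
      · exact absurd ⟨F, hF, rfl⟩ h.2
    refine ⟨fun v => if θ v ∈ adom db then θ v else d, ?_⟩
    intro A hA
    obtain ⟨F, hF, rfl⟩ := Finset.mem_image.1 hA
    by_cases hFq : F ∈ q'
    · have hmem := hθ' F hFq
      have hmdb : appA θ F ∈ db := (hin (appA θ F) ⟨F, hFq, rfl⟩).1 (hr.1 hmem)
      convert hmem using 1
      unfold appA
      congr 1
      apply List.map_congr_left
      intro t ht
      rcases t with v | c
      · have : θ v ∈ adom db := by
          refine Finset.mem_biUnion.2 ⟨_, hmdb, mem_constsA.2 ?_⟩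
          exact List.mem_map.2 ⟨_, ht, rfl⟩
        simp [appT, this]
      · rfl
    · have hFm : F ∈ q \ q' := Finset.mem_sdiff.2 ⟨hF, hFq⟩
      have hm : appA (fun v => if θ v ∈ adom db then θ v else d) F ∈ fdb := by
        rw [hfdb]
        refine Or.inr ⟨F, hFm, rfl, by simp [appA], ?_⟩
        intro t ht
        obtain ⟨u, hu, rfl⟩ := List.mem_map.1 ht
        rcases u with v | c
        · refine ⟨if θ v ∈ adom db then θ v else d, ?_, rfl⟩
          split_ifs with h
          · exact h
          · exact hd
        · have := mem_constsA.2 hu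
          rw [(hallkey F hFm).2] at this
          exact absurd this (Finset.notMem_empty c)
      obtain ⟨B, hB, hAB⟩ := hrc _ hm
      rw [eq_of_allKey (hfwf _ hm) (hfwf B (hr.1 hB)) (hallkey F hFm).1 hAB]
      exact hB
  · intro hC r hr
    have hrc := cover_of_isRepair hr
    obtain ⟨θ, hθ⟩ := hC (r.filter (fun A => ∃ F ∈ q', A.rel = F.rel) ∪
      fdb.filter (fun A => ¬ ∃ F ∈ q', A.rel = F.rel)) (by
        apply isRepair_of_cover
        · intro A hA
          rw [Finset.mem_union, Finset.mem_filter, Finset.mem_filter] at hA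
          rcases hA with hA | hA
          · exact (hin A hA.2).2 (hr.1 hA.1)
          · exact hA.1
        · intro A hA B hB hAB
          rw [Finset.mem_union, Finset.mem_filter, Finset.mem_filter] at hA
          rw [Finset.mem_union, Finset.mem_filter, Finset.mem_filter, ← hAB.1] at hB
          rcases hA with hA | hA <;> rcases hB with hB | hB
          · exact hr.2.1 A hA.1 B hB.1 hAB
          · exact absurd hA.2 hB.2
          · exact absurd hB.2 hA.2
          · exact eq_of_allKey (hfwf A hA.1) (hfwf B hB.1) (hout A hA.1 hA.2) hAB
        · intro A hA
          by_cases h : ∃ F ∈ q', A.rel = F.rel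
          · obtain ⟨B, hB, hAB⟩ := hrc A ((hin A h).1 hA)
            refine ⟨B, ?_, hAB⟩
            rw [Finset.mem_union, Finset.mem_filter]
            exact Or.inl ⟨hB, hAB.1 ▸ h⟩
          · refine ⟨A, ?_, rfl, rfl⟩
            rw [Finset.mem_union, Finset.mem_filter, Finset.mem_filter]
            exact Or.inr ⟨hA, h⟩)
    refine ⟨θ, fun A hA => ?_⟩
    obtain ⟨F, hF, rfl⟩ := Finset.mem_image.1 hA
    have := hθ (Finset.mem_image_of_mem _ (hsub hF))
    rw [Finset.mem_union, Finset.mem_filter, Finset.mem_filter] at this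
    rcases this with h | h
    · exact h.1
    · exact absurd ⟨F, hF, rfl⟩ h.2
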